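/- arXiv:2004.07479 — 10 statements merged into one kernel-verified Lean document; each statement's English description precedes it below -/
import Mathlib

section
/- Let P be a nonempty zero-dimensional Polish space and let B ⊆ P be a G_δ subset such that both B and its complement P ∖ B are dense in P. Then B, with the subspace topology, is homeomorphic to the Baire set ℕ^ℕ (the space of functions ℕ → ℕ with the product topology). -/
open Set Filter Topology PiNat CantorScheme

/-- In a zero-dimensional second countable metric space, an open set which is not closed is the
disjoint union of a sequence of nonempty clopen sets of arbitrarily small diameter. -/
theorem exists_clopen_partition_of_not_isClosed {P : Type*} [PseudoMetricSpace P]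
    [SecondCountableTopology P]
    (hzd : TopologicalSpace.IsTopologicalBasis {s : Set P | IsClopen s})
    {W : Set P} (hW : IsOpen W) (hWc : ¬ IsClosed W) {ε : ENNReal} (hε : 0 < ε) :
    ∃ D : ℕ → Set P, (∀ n, IsClopen (D n)) ∧ (∀ n, (D n).Nonempty) ∧
      (∀ n, Metric.ediam (D n) ≤ ε) ∧ Pairwise (Function.onFun Disjoint D) ∧ ⋃ n, D n = W := by
  let S : Set (Set P) := {V | IsClopen V ∧ V ⊆ W ∧ Metric.ediam V ≤ ε}
  have hSW : ⋃₀ S = W := by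
    refine subset_antisymm (sUnion_subset fun V hV => hV.2.1) fun x hx => ?_
    obtain ⟨V, hV, hxV, hVs⟩ := hzd.exists_subset_of_mem_open
      (show x ∈ W ∩ Metric.eball x (ε / 2) from
        ⟨hx, Metric.mem_eball_self (ENNReal.half_pos hε.ne')⟩)
      (hW.inter Metric.isOpen_eball)
    refine mem_sUnion_of_mem hxV ⟨hV, hVs.trans inter_subset_left, ?_⟩
    refine (Metric.ediam_mono (hVs.trans inter_subset_right)).trans
      (Metric.ediam_eball_le.trans ?_)
    rw [ENNReal.mul_div_cancel two_ne_zero ENNReal.ofNat_ne_top]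
  obtain ⟨T, hTc, hTS, hTU⟩ := TopologicalSpace.isOpen_sUnion_countable S fun V hV => hV.1.isOpen
  have hTne : T.Nonempty := by
    rw [nonempty_iff_ne_empty]
    rintro rfl
    rw [hSW, sUnion_empty] at hTU
    exact hWc (hTU ▸ isClosed_empty)
  obtain ⟨f, rfl⟩ := hTc.exists_eq_range hTne
  have hfS : ∀ n, f n ∈ S := fun n => hTS (mem_range_self n)
  have hclopen : ∀ n, IsClopen (disjointed f n) := fun n =>
    disjointedRec (fun _ i h => h.diff (hfS i).1) (hfS n).1
  have hU : ⋃ n, disjointed f n = W := by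
    rw [iUnion_disjointed, ← sUnion_range, hTU, hSW]
  let I : Set ℕ := {n | (disjointed f n).Nonempty}
  have hIU : ⋃ n ∈ I, disjointed f n = W := by
    rw [← hU]
    refine subset_antisymm (iUnion₂_subset_iUnion _ _) (iUnion_subset fun n x hx => ?_)
    exact mem_biUnion (show n ∈ I from ⟨x, hx⟩) hx
  have hI : I.Infinite := fun hfin =>
    hWc (hIU ▸ hfin.isClosed_biUnion fun n _ => (hclopen n).isClosed)
  have := hI.to_subtype
  obtain ⟨e⟩ := nonempty_equiv_of_countable (α := ℕ) (β := I)
  refine ⟨fun n => disjointed f (e n), fun n => hclopen _, fun n => (e n).2, fun n => ?_, ?_, ?_⟩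
  · exact (Metric.ediam_mono (disjointed_subset f _)).trans (hfS _).2.2
  · exact fun m n hmn => disjoint_disjointed f fun h => hmn (e.injective (Subtype.ext h))
  · rw [e.surjective.iUnion_comp fun i : I => disjointed f i, ← hIU, biUnion_eq_iUnion]

/-- A clopen set in a zero-dimensional space contains a disjoint sequence of small nonempty clopen
sets which lie in a prescribed open set and cover all points of a dense and codense set. -/
theorem exists_clopen_children {P : Type*} [MetricSpace P] [SecondCountableTopology P]
    (hzd : TopologicalSpace.IsTopologicalBasis {s : Set P | IsClopen s})
    {B : Set P} (hB : Dense B) (hBc : Dense Bᶜ) {C U : Set P} (hC : IsClopen C)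
    (hCne : C.Nonempty) (hU : IsOpen U) (hBU : B ⊆ U) {ε : ENNReal} (hε : 0 < ε) :
    ∃ D : ℕ → Set P, (∀ n, IsClopen (D n)) ∧ (∀ n, (D n).Nonempty) ∧
      (∀ n, Metric.ediam (D n) ≤ ε) ∧ Pairwise (Function.onFun Disjoint D) ∧
      (∀ n, D n ⊆ C ∩ U) ∧ C ∩ B ⊆ ⋃ n, D n := by
  obtain ⟨c, hcC, hcB⟩ := hBc.inter_open_nonempty C hC.isOpen hCne
  have hsub : C ∩ B ⊆ (C ∩ U) \ {c} := fun x hx =>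
    ⟨⟨hx.1, hBU hx.2⟩, fun h => hcB (mem_singleton_iff.1 h ▸ hx.2)⟩
  have hWc : ¬ IsClosed ((C ∩ U) \ {c}) := fun h =>
    (h.closure_subset_iff.2 hsub (hB.open_subset_closure_inter hC.isOpen hcC)).2 rfl
  obtain ⟨D, hD₁, hD₂, hD₃, hD₄, hD₅⟩ := exists_clopen_partition_of_not_isClosed hzd
    ((hC.isOpen.inter hU).sdiff isClosed_singleton) hWc hε
  exact ⟨D, hD₁, hD₂, hD₃, hD₄,
    fun n => (subset_iUnion D n).trans (hD₅.subset.trans sdiff_subset), hsub.trans hD₅.superset⟩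

/-- If `x` lies in the members of a disjoint antitone scheme along the branches `a` and `b`
up to level `n`, then these branches agree up to level `n`. -/
theorem CantorScheme.Disjoint.res_eq_of_mem {α β : Type*} {A : List β → Set α}
    (hd : CantorScheme.Disjoint A) (ha : CantorScheme.Antitone A) {x : α} {a b : ℕ → β} {n : ℕ}
    (hxa : x ∈ A (res a n)) (hxb : x ∈ A (res b n)) : res a n = res b n := by
  induction n with
  | zero => simp
  | succ n ih =>
    rw [res_succ] at hxa hxb
    have h := ih (ha _ _ hxa) (ha _ _ hxb)
    rw [h] at hxa
    by_cases hab : a n = b n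
    · rw [res_succ, res_succ, h, hab]
    · exact (disjoint_left.1 (hd _ hab) hxa hxb).elim

/-- A scheme of nonempty clopen sets with vanishing diameter on a complete metric space, which is
disjoint and antitone, identifies the sequence space with the set `B` of points of its branches,
provided that the children of each member cover its intersection with `B`. -/
theorem CantorScheme.nonempty_homeomorph {P β : Type*} [MetricSpace P] [CompleteSpace P]
    [TopologicalSpace β] [DiscreteTopology β] {A : List β → Set P} {B : Set P}
    (hclopen : ∀ l, IsClopen (A l)) (hne : ∀ l, (A l).Nonempty) (hd : CantorScheme.Disjoint A)
    (ha : CantorScheme.Antitone A) (hdiam : VanishingDiam A)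
    (hsub : ∀ x : ℕ → β, ⋂ n, A (res x n) ⊆ B) (hnil : B ⊆ A [])
    (hcover : ∀ l, A l ∩ B ⊆ ⋃ b, A (b :: l)) :
    Nonempty (B ≃ₜ (ℕ → β)) := by
  have htot := (ha.closureAntitone fun l => (hclopen l).isClosed).map_of_vanishingDiam hdiam hne
  let f : (ℕ → β) → B := fun x => ⟨(inducedMap A).2 ⟨x, htot ▸ mem_univ x⟩,
    hsub x (mem_iInter.2 (map_mem _))⟩
  have hfmem : ∀ x n, (f x : P) ∈ A (res x n) := fun x n => map_mem _ n
  have hfcont : Continuous f :=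
    (hdiam.map_continuous.comp (continuous_id.subtype_mk _)).subtype_mk _
  have hfinj : Function.Injective f := fun x y hxy =>
    congrArg Subtype.val (hd.map_injective (a₁ := ⟨x, htot ▸ mem_univ x⟩)
      (a₂ := ⟨y, htot ▸ mem_univ y⟩) (Subtype.ext_iff.1 hxy))
  have hfsurj : Function.Surjective f := by
    rintro ⟨p, hp⟩
    have hstep : ∀ l : {l // p ∈ A l}, ∃ b, p ∈ A (b :: l.1) := fun l =>
      mem_iUnion.1 (hcover _ ⟨l.2, hp⟩)
    choose g hg using hstep
    let L : ℕ → {l // p ∈ A l} := fun n =>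
      Nat.rec ⟨[], hnil hp⟩ (fun _ l => ⟨g l :: l.1, hg l⟩) n
    have hL : ∀ n, res (fun k => g (L k)) n = (L n).1 := by
      intro n
      induction n with
      | zero => rfl
      | succ n ih => rw [res_succ, ih]
    refine ⟨fun k => g (L k), Subtype.ext (eq_of_forall_dist_le fun ε hε => ?_)⟩
    obtain ⟨n, hn⟩ := hdiam.dist_lt ε hε fun k => g (L k)
    exact (hn _ (hfmem _ n) _ ((hL n).symm ▸ (L n).2)).le
  have hfopen : IsOpenMap f := by
    refine IsOpenMap.of_nhds_le fun x s hs => ?_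
    obtain ⟨t, ⟨y, n, rfl⟩, hxt, hts⟩ :=
      (isTopologicalBasis_cylinders fun _ : ℕ => β).mem_nhds_iff.1 (mem_map.1 hs)
    have hnhds : Subtype.val ⁻¹' A (res x n) ∈ 𝓝 (f x) :=
      ((hclopen _).isOpen.preimage continuous_subtype_val).mem_nhds (hfmem x n)
    refine mem_of_superset hnhds fun p hp => ?_
    obtain ⟨z, rfl⟩ := hfsurj p
    refine hts ?_
    rw [cylinder_eq_res] at hxt ⊢
    exact (hd.res_eq_of_mem ha (hfmem z n) hp).trans hxt
  exact ⟨((Equiv.ofBijective f ⟨hfinj, hfsurj⟩).toHomeomorphOfContinuousOpen hfcont hfopen).symm⟩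

/-- A dense `Gδ` subset with dense complement in a nonempty zero-dimensional Polish space
is homeomorphic to the Baire set `ℕ → ℕ`. -/
theorem stmt4 {P : Type*} [TopologicalSpace P] [PolishSpace P] [Nonempty P]
    (hzd : TopologicalSpace.IsTopologicalBasis {s : Set P | IsClopen s})
    (B : Set P) (hGδ : IsGδ B) (hBdense : Dense B) (hCdense : Dense Bᶜ) :
    Nonempty (B ≃ₜ (ℕ → ℕ)) := by
  let := TopologicalSpace.upgradeIsCompletelyMetrizable P
  obtain ⟨U, hUo, hBU⟩ := isGδ_iff_eq_iInter_nat.1 hGδ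
  have hstep : ∀ (C : {C : Set P // IsClopen C ∧ C.Nonempty}) (n : ℕ),
      ∃ D : ℕ → {C : Set P // IsClopen C ∧ C.Nonempty},
        (∀ k, Metric.ediam (D k).1 ≤ (n : ENNReal)⁻¹) ∧
        Pairwise (fun i j => Disjoint (D i).1 (D j).1) ∧
        (∀ k, (D k).1 ⊆ C.1 ∩ U n) ∧ C.1 ∩ B ⊆ ⋃ k, (D k).1 := by
    intro C n
    obtain ⟨D, hD₁, hD₂, hD₃⟩ := exists_clopen_children hzd hBdense hCdense C.2.1 C.2.2 (hUo n)
      (hBU.subset.trans (iInter_subset U n))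
      (ENNReal.inv_pos.2 (ENNReal.natCast_ne_top n))
    exact ⟨fun k => ⟨D k, hD₁ k, hD₂ k⟩, hD₃⟩
  choose D hDdiam hDdisj hDsub hDcover using hstep
  let A : List ℕ → {C : Set P // IsClopen C ∧ C.Nonempty} := fun l =>
    List.rec ⟨univ, isClopen_univ, univ_nonempty⟩ (fun a l C => D C l.length a) l
  refine CantorScheme.nonempty_homeomorph (A := fun l => (A l).1) (fun l => (A l).2.1)
    (fun l => (A l).2.2) (fun l => hDdisj (A l) l.length)
    (fun l a => (hDsub (A l) l.length a).trans inter_subset_left) (fun x => ?_) (fun x => ?_)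
    (subset_univ B) (fun l => hDcover (A l) l.length)
  · rw [← tendsto_add_atTop_iff_nat 1]
    refine tendsto_of_tendsto_of_tendsto_of_le_of_le tendsto_const_nhds
      ENNReal.tendsto_inv_nat_nhds_zero (fun _ => zero_le) fun n => ?_
    have h := hDdiam (A (res x n)) (res x n).length (x n)
    nth_rw 2 [res_length] at h
    exact h
  · rw [hBU]
    refine subset_iInter fun n p hp => ?_
    have h := (hDsub (A (res x n)) (res x n).length (x n) (mem_iInter.1 hp (n + 1))).2
    rwa [res_length] at h
end

section
/- Let X be a nonempty Polish space without isolated points, and let G be a countable group acting on X by homeomorphisms such that the action is topologically transitive. Then for every Polish space P there is no Borel measurable map β : X → P such that for all x, y ∈ X one has β(x) = β(y) if and only if x and y lie in the same G-orbit. (In other words, the orbit equivalence relation of such an action is not smooth.) -/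
open Pointwise MeasureTheory

open Filter Topology in
/-- Topological zero-one law: a set with the property of Baire which is invariant under a
topologically transitive action of a countable group is either residual or meagre. -/
theorem BaireMeasurableSet.mem_residual_or_isMeagre_of_invariant {X G : Type*}
    [TopologicalSpace X] [Group G] [Countable G] [MulAction G X] [ContinuousConstSMul G X]
    [MulAction.IsTopologicallyTransitive G X] {s : Set X} (hs : BaireMeasurableSet s)
    (hinv : ∀ g : G, (g • ·) ⁻¹' s = s) : s ∈ residual X ∨ IsMeagre s := by
  obtain ⟨u, huo, hsu⟩ := hs.residualEq_isOpen
  rcases u.eq_empty_or_nonempty with rfl | hne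
  · right
    filter_upwards [hsu.mem_iff] with x hx using by simpa using hx
  · left
    have htranslate (g : G) : ∀ᶠ x in residual X, x ∈ s ↔ g • x ∈ u := by
      have h := (tendsto_residual_of_isOpenMap (continuous_const_smul g)
        (isOpenMap_smul g)).eventually hsu.mem_iff
      filter_upwards [h] with x hx
      rw [← hx]
      exact (Set.ext_iff.1 (hinv g) x).symm
    have hdense : (⋃ g : G, (g • ·) ⁻¹' u) ∈ residual X :=
      residual_of_dense_open (isOpen_iUnion fun g ↦ huo.preimage (continuous_const_smul g))
        (huo.dense_iUnion_preimage_smul G hne)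
    filter_upwards [eventually_countable_forall.2 htranslate, hdense] with x hx hxu
    obtain ⟨g, hg⟩ := Set.mem_iUnion.1 hxu
    exact (hx g).2 hg

open Filter Topology in
/-- In a T₁ space without isolated points, every countable set is meagre. -/
theorem Set.Countable.isMeagre {X : Type*} [TopologicalSpace X] [T1Space X]
    (hperf : ∀ x : X, (𝓝[≠] x).NeBot) {s : Set X} (hs : s.Countable) : IsMeagre s := by
  have h : ∀ᶠ y in residual X, ∀ x ∈ s, y ≠ x :=
    (eventually_countable_ball hs).2 fun x _ ↦
      have := hperf x
      residual_of_dense_open isOpen_compl_singleton (dense_compl_singleton x)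
  filter_upwards [h] with y hy hys using hy y hys rfl

/-- If a countable group `G` acts topologically transitively by homeomorphisms on a nonempty
perfect Polish space `X`, then the orbit equivalence relation is not smooth: there is no
Borel measurable map `β` from `X` to a Polish space separating the orbits. -/
theorem stmt5 {X : Type*} [TopologicalSpace X] [PolishSpace X] [Nonempty X]
    (hperf : ∀ x : X, (nhdsWithin x {x}ᶜ).NeBot)
    {G : Type*} [Group G] [Countable G] [MulAction G X] [ContinuousConstSMul G X]
    (htrans : ∀ U V : Set X, IsOpen U → IsOpen V → U.Nonempty → V.Nonempty →
      ∃ g : G, (g • U ∩ V).Nonempty)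
    (P : Type*) [TopologicalSpace P] [PolishSpace P] (β : X → P)
    (hβ : ∀ U : Set P, IsOpen U → MeasurableSet[borel X] (β ⁻¹' U)) :
    ¬ (∀ x y : X, β x = β y ↔ ∃ g : G, g • x = y) := by
  intro h
  have : MulAction.IsTopologicallyTransitive G X :=
    ⟨fun hU hUne hV hVne ↦ htrans _ _ hU hV hUne hVne⟩
  have hzo (U : Set P) (hU : IsOpen U) :
      (∀ᶠ x in residual X, β x ∈ U) ∨ ∀ᶠ x in residual X, β x ∉ U := by
    borelize X
    refine (hβ U hU).baireMeasurableSet.mem_residual_or_isMeagre_of_invariant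
      (G := G) fun g ↦ ?_
    ext x
    simp only [Set.mem_preimage, (h x (g • x)).2 ⟨g, rfl⟩]
  have : Nonempty P := ‹Nonempty X›.map β
  obtain ⟨c, hc⟩ := Filter.exists_eventuallyEq_const_of_forall_separating IsOpen hzo
  obtain ⟨x, hx⟩ := (dense_of_mem_residual hc).nonempty
  have horbit : (MulAction.orbit G x).Countable := Set.countable_range _
  obtain ⟨y, hyc, hy⟩ :=
    (dense_of_mem_residual (Filter.inter_mem hc (horbit.isMeagre hperf))).nonempty
  exact hy ((h x y).1 (hx.trans hyc.symm))
end

section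
/- Let F be the free group on a countably infinite basis (x_i)_{i ∈ ℕ}, and let N and N' be normal subgroups of F each of which contains x_i for all but finitely many i ∈ ℕ. Then the quotient groups F/N and F/N' are isomorphic if and only if there exists an automorphism α of F with α(x_i) = x_i for all but finitely many i such that α(N) = N'. -/
namespace FreeGroup

variable {ι Q : Type*} [Group Q]

/-- The transvection multiplying each basis element `i` by `w i`, where the `w i` lie in the
subgroup generated by basis elements on which `w` is trivial. -/
theorem exists_mulEquiv_of_mul {S : Set ι} {w : ι → FreeGroup ι}
    (hw : ∀ i, w i ∈ Subgroup.closure (of '' S)) (hS : ∀ i ∈ S, w i = 1) :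
    ∃ σ : FreeGroup ι ≃* FreeGroup ι, ∀ i, σ (of i) = of i * w i := by
  have fixed (f : FreeGroup ι →* FreeGroup ι) (hf : ∀ i ∈ S, f (of i) = of i) (i : ι) :
      f (w i) = w i := by
    have h : Set.EqOn f (MonoidHom.id _) (Subgroup.closure (of '' S)) := by
      apply MonoidHom.eqOn_closure
      rintro _ ⟨j, hj, rfl⟩
      exact hf j hj
    exact h (hw i)
  let f : FreeGroup ι →* FreeGroup ι := lift fun i => of i * w i
  let g : FreeGroup ι →* FreeGroup ι := lift fun i => of i * (w i)⁻¹
  have hf : ∀ i, f (w i) = w i := fixed f fun i hi => by simp [f, hS i hi]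
  have hg : ∀ i, g (w i) = w i := fixed g fun i hi => by simp [g, hS i hi]
  have hf' : ∀ i, f (of i) = of i * w i := fun i => by simp [f]
  have hg' : ∀ i, g (of i) = of i * (w i)⁻¹ := fun i => by simp [g]
  refine ⟨f.toMulEquiv g ?_ ?_, hf'⟩
  · ext i
    simp [hf', hg', hg]
  · ext i
    simp [hf', hg', hf]

/-- A surjection from a free group that kills all basis elements outside `S` is already surjective
on the subgroup generated by `S`. -/
theorem exists_mem_closure_of_surjective {φ : FreeGroup ι →* Q} (hφ : Function.Surjective φ)
    {S : Set ι} (hS : ∀ i ∉ S, φ (of i) = 1) (q : Q) :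
    ∃ x ∈ Subgroup.closure (of '' S), φ x = q := by
  classical
  obtain ⟨x, rfl⟩ := hφ q
  let r : FreeGroup ι →* FreeGroup ι := lift fun i => if i ∈ S then of i else 1
  refine ⟨r x, ?_, ?_⟩
  · refine range_lift_le (s := Subgroup.closure (of '' S)) ?_ ⟨x, rfl⟩
    rintro _ ⟨i, rfl⟩
    dsimp only
    split_ifs with hi
    · exact Subgroup.subset_closure ⟨i, hi, rfl⟩
    · exact one_mem _
  · have h : φ.comp r = φ := by
      ext i
      by_cases hi : i ∈ S <;> simp [r, hi, hS]
    exact DFunLike.congr_fun h x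

/-- If `φ` is surjective and kills the basis elements from `n` on, a finitary automorphism turns it
into a homomorphism with prescribed values on the basis elements from `n` to `2 * n - 1`. -/
theorem exists_mulEquiv_apply_of {φ : FreeGroup ℕ →* Q} (hφ : Function.Surjective φ) {n : ℕ}
    (hn : ∀ i, n ≤ i → φ (of i) = 1) (b : ℕ → Q) :
    ∃ σ : FreeGroup ℕ ≃* FreeGroup ℕ, (∀ i, 2 * n ≤ i → σ (of i) = of i) ∧
      ∀ i, φ (σ (of i)) = if i < n then φ (of i) else if i < 2 * n then b (i - n) else 1 := by
  choose W hW hφW using exists_mem_closure_of_surjective hφ (S := Set.Iio n)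
    fun i hi => hn i (by simpa using hi)
  obtain ⟨σ, hσ⟩ := exists_mulEquiv_of_mul (S := Set.Iio n)
    (w := fun i => if i < n then 1 else if i < 2 * n then W (b (i - n)) else 1)
    (fun i => by
      split_ifs
      · exact one_mem _
      · exact hW _
      · exact one_mem _)
    (fun i hi => if_pos hi)
  refine ⟨σ, fun i hi => ?_, fun i => ?_⟩
  · simp [hσ, show ¬ i < n by lia, show ¬ i < 2 * n by lia]
  · rw [hσ]
    split_ifs with h₁ h₂
    · simp
    · simp [hφW, hn i (by lia)]
    · simp [hn i (by lia)]

/-- Two surjections from the free group on `ℕ` that kill almost all basis elements differ by a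
finitary automorphism. -/
theorem exists_mulEquiv_comp_eq {φ ψ : FreeGroup ℕ →* Q} (hφ : Function.Surjective φ)
    (hψ : Function.Surjective ψ) {n : ℕ} (hφn : ∀ i, n ≤ i → φ (of i) = 1)
    (hψn : ∀ i, n ≤ i → ψ (of i) = 1) :
    ∃ α : FreeGroup ℕ ≃* FreeGroup ℕ, (∀ i, 2 * n ≤ i → α (of i) = of i) ∧
      ∀ x, ψ (α x) = φ x := by
  obtain ⟨σ, hσ, hφσ⟩ := exists_mulEquiv_apply_of hφ hφn fun i => ψ (of i)
  obtain ⟨τ, hτ, hψτ⟩ := exists_mulEquiv_apply_of hψ hψn fun i => φ (of i)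
  let s : ℕ → ℕ := fun i => if i < n then i + n else if i < 2 * n then i - n else i
  have hs : Function.Involutive s := fun i => by
    simp only [s]
    grind
  let e : FreeGroup ℕ ≃* FreeGroup ℕ := freeGroupCongr hs.toPerm
  have he : ∀ i, e (of i) = of (s i) := fun i => by simp [e]
  have key : ψ.comp (τ.toMonoidHom.comp e.toMonoidHom) = φ.comp σ.toMonoidHom := by
    ext i
    simp only [MonoidHom.comp_apply, MulEquiv.toMonoidHom_eq_coe, MonoidHom.coe_coe, he, hψτ, hφσ]
    simp only [s]
    grind
  refine ⟨σ.symm.trans (e.trans τ), fun i hi => ?_, fun x => ?_⟩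
  · have h₁ : σ.symm (of i) = of i := by rw [MulEquiv.symm_apply_eq, hσ i hi]
    have h₂ : s i = i := by simp only [s]; grind
    simp [h₁, he, h₂, hτ i hi]
  · simpa using DFunLike.congr_fun key (σ.symm x)

end FreeGroup

/-- Thomas's lemma: for normal subgroups `N, N'` of the free group on a countably infinite
basis, each containing all but finitely many basis elements, the quotients `F/N` and `F/N'`
are isomorphic iff some finitary automorphism of `F` (fixing all but finitely many basis
elements) maps `N` onto `N'`. -/
theorem stmt6 (N N' : Subgroup (FreeGroup ℕ)) [N.Normal] [N'.Normal]
    (hN : {i : ℕ | FreeGroup.of i ∉ N}.Finite)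
    (hN' : {i : ℕ | FreeGroup.of i ∉ N'}.Finite) :
    Nonempty ((FreeGroup ℕ ⧸ N) ≃* (FreeGroup ℕ ⧸ N')) ↔
      ∃ α : FreeGroup ℕ ≃* FreeGroup ℕ,
        {i : ℕ | α (FreeGroup.of i) ≠ FreeGroup.of i}.Finite ∧
        Subgroup.map α.toMonoidHom N = N' := by
  constructor
  · rintro ⟨e⟩
    obtain ⟨m, hm⟩ := (hN.union hN').bddAbove
    have hmem : ∀ i, m + 1 ≤ i → FreeGroup.of i ∈ N ∧ FreeGroup.of i ∈ N' := fun i hi => by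
      by_contra h
      have : i ≤ m := hm (by simpa [imp_iff_not_or] using not_and_or.mp h)
      lia
    obtain ⟨α, hα, hcomp⟩ := FreeGroup.exists_mulEquiv_comp_eq (n := m + 1)
      (φ := e.toMonoidHom.comp (QuotientGroup.mk' N)) (ψ := QuotientGroup.mk' N')
      (e.surjective.comp (QuotientGroup.mk'_surjective N)) (QuotientGroup.mk'_surjective N')
      (fun i hi => by simp [(QuotientGroup.eq_one_iff _).2 (hmem i hi).1])
      (fun i hi => (QuotientGroup.eq_one_iff _).2 (hmem i hi).2)
    have hiff : ∀ x, α x ∈ N' ↔ x ∈ N := fun x => by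
      rw [← QuotientGroup.eq_one_iff, ← QuotientGroup.eq_one_iff (N := N)]
      have h : ((α x : FreeGroup ℕ) : FreeGroup ℕ ⧸ N') = e (x : FreeGroup ℕ ⧸ N) := hcomp x
      rw [h, map_eq_one_iff e e.injective]
    refine ⟨α, (Set.finite_lt_nat (2 * (m + 1))).subset fun i hi => ?_, ?_⟩
    · by_contra h
      exact hi (hα i (by simpa using h))
    · ext y
      obtain ⟨x, rfl⟩ := α.surjective y
      rw [hiff]
      exact Subgroup.mem_map_iff_mem (f := α.toMonoidHom) α.injective
  · rintro ⟨α, -, h⟩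
    exact ⟨QuotientGroup.congr N N' α h⟩
end

section
/- Let F be the free group of finite rank n, let R ⊆ F be a finite subset, and let N be the normal closure of R in F. Identify the power set of F with the product space F → Prop carrying the product topology. Then the set U = {s ⊆ F | R ⊆ s} is open in this product topology, the underlying set of N belongs to U, and every normal subgroup N' of F whose underlying set belongs to U satisfies N ≤ N'; in particular, for every such N' there is a surjective group homomorphism F/N → F/N', i.e., F/N' is a quotient of the finitely presented group F/N. -/
/-- A finitely presented marked group has a neighborhood consisting of its quotients: for a
finite `R` in the free group `F` of rank `n` with normal closure `N`, the set
`U = {s | R ⊆ s}` is open in the product space `F → Bool`, contains (the characteristic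
function of) `N`, and every normal subgroup `N'` whose characteristic function lies in `U`
contains `N`; in particular `F/N'` is a quotient of `F/N`. -/
theorem stmt8 (n : ℕ) (R : Finset (FreeGroup (Fin n))) :
    IsOpen {χ : FreeGroup (Fin n) → Bool | ∀ r ∈ R, χ r = true} ∧
    (∃ χ ∈ {χ : FreeGroup (Fin n) → Bool | ∀ r ∈ R, χ r = true},
      ∀ x : FreeGroup (Fin n),
        χ x = true ↔ x ∈ Subgroup.normalClosure (↑R : Set (FreeGroup (Fin n)))) ∧
    ∀ (N' : Subgroup (FreeGroup (Fin n))) [N'.Normal],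
      (∃ χ ∈ {χ : FreeGroup (Fin n) → Bool | ∀ r ∈ R, χ r = true},
        ∀ x : FreeGroup (Fin n), χ x = true ↔ x ∈ N') →
      Subgroup.normalClosure (↑R : Set (FreeGroup (Fin n))) ≤ N' ∧
      ∃ φ : (FreeGroup (Fin n) ⧸ Subgroup.normalClosure (↑R : Set (FreeGroup (Fin n)))) →*
          FreeGroup (Fin n) ⧸ N', Function.Surjective φ := by
  classical
  refine ⟨?_, ⟨fun x => decide (x ∈ Subgroup.normalClosure (R : Set (FreeGroup (Fin n)))),
    fun r hr => decide_eq_true (Subgroup.subset_normalClosure hr), fun x => decide_eq_true_iff⟩, ?_⟩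
  · simp only [Set.ofPred_forall]
    exact isOpen_biInter_finset fun r _ =>
      (isOpen_discrete ({true} : Set Bool)).preimage
        (continuous_apply (A := fun _ : FreeGroup (Fin n) => Bool) r)
  · rintro N' _ ⟨χ, hχ, hN'⟩
    have h : Subgroup.normalClosure (R : Set (FreeGroup (Fin n))) ≤ N' :=
      Subgroup.normalClosure_le_normal fun r hr => (hN' r).1 (hχ r hr)
    exact ⟨h, QuotientGroup.map _ N' (MonoidHom.id _) h,
      QuotientGroup.map_surjective_of_surjective _ N' (MonoidHom.id _)
        (QuotientGroup.mk'_surjective N') h⟩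
end

section
/- Let F be the free group of finite rank n. Identify the power set of F with the product space F → Prop carrying the product topology. Then the set of all subsets of F that are the underlying set of the normal closure of some finite subset of F is dense in the set of all subsets of F that are the underlying set of a normal subgroup of F (with the subspace topology). In other words, every marked group on n generators is a limit of finitely presented marked groups. -/
/-- Every marked group on `n` generators is a limit of finitely presented marked groups: in
the product space `F → Bool` (`F` the free group of rank `n`), every characteristic function
of a normal subgroup of `F` lies in the closure of the set of characteristic functions of
normal closures of finite subsets of `F`. -/
theorem stmt9 (n : ℕ) :
    {χ : FreeGroup (Fin n) → Bool |
        ∃ N : Subgroup (FreeGroup (Fin n)), N.Normal ∧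
          ∀ x : FreeGroup (Fin n), χ x = true ↔ x ∈ N} ⊆
      closure {χ : FreeGroup (Fin n) → Bool |
        ∃ R : Finset (FreeGroup (Fin n)),
          ∀ x : FreeGroup (Fin n),
            χ x = true ↔ x ∈ Subgroup.normalClosure (↑R : Set (FreeGroup (Fin n)))} := by
  classical
  rintro χ ⟨N, hN, hχ⟩
  rw [mem_closure_iff]
  intro U hU hχU
  obtain ⟨I, u, hu, hIU⟩ := isOpen_pi_iff.mp hU χ hχU
  let R : Finset (FreeGroup (Fin n)) := I.filter fun x => χ x = true
  have hRN : Subgroup.normalClosure (↑R : Set (FreeGroup (Fin n))) ≤ N :=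
    Subgroup.normalClosure_le_normal fun x hx =>
      (hχ x).mp (Finset.mem_filter.mp (Finset.mem_coe.mp hx)).2
  refine ⟨fun x => decide (x ∈ Subgroup.normalClosure (↑R : Set (FreeGroup (Fin n)))),
    hIU fun x hx => ?_, R, fun x => decide_eq_true_iff⟩
  have hagree : decide (x ∈ Subgroup.normalClosure (↑R : Set (FreeGroup (Fin n)))) = χ x := by
    rw [Bool.eq_iff_iff, decide_eq_true_iff]
    exact ⟨fun h => (hχ x).mpr (hRN h), fun h => Subgroup.subset_normalClosure
      (Finset.mem_coe.mpr (Finset.mem_filter.mpr ⟨hx, h⟩))⟩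
  simpa only [hagree] using (hu x hx).2
end

section
/- Let F be the free group of finite rank n, let N be a normal subgroup of F, and suppose the quotient group G = F/N is extremely non-Hopfian. Identify the power set of F with the product space F → Prop carrying the product topology, and let S = {s ⊆ F | s is the underlying set of a normal subgroup N' of F with F/N' isomorphic to G}. Then the underlying set of N lies in the closure of S ∖ {N}; that is, N is an accumulation point of the isomorphism class of G in the space of marked groups on n generators, so G is condensed. -/
/-- If the quotient `G = F/N` of the free group `F` of rank `n` by a normal subgroup `N` is
extremely non-Hopfian, then (the characteristic function of) `N` is an accumulation point of
the isomorphism class of `G` in the product space `F → Bool`; here a normal subgroup `N'`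
satisfies `F/N' ≅ G` iff `N'` is the kernel of a surjective homomorphism `F → G`. -/
theorem stmt10 (n : ℕ) (N : Subgroup (FreeGroup (Fin n))) [N.Normal]
    (hENH : ∀ 𝓕 : Finset (FreeGroup (Fin n) ⧸ N),
      ∃ φ : (FreeGroup (Fin n) ⧸ N) →* FreeGroup (Fin n) ⧸ N,
        Function.Surjective φ ∧ ¬Function.Injective φ ∧
          Set.InjOn φ (↑𝓕 : Set (FreeGroup (Fin n) ⧸ N))) :
    ∀ χ : FreeGroup (Fin n) → Bool, (∀ x : FreeGroup (Fin n), χ x = true ↔ x ∈ N) →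
      χ ∈ closure
        ({χ' : FreeGroup (Fin n) → Bool |
            ∃ N' : Subgroup (FreeGroup (Fin n)), N'.Normal ∧
              (∀ x : FreeGroup (Fin n), χ' x = true ↔ x ∈ N') ∧
              ∃ ψ : FreeGroup (Fin n) →* FreeGroup (Fin n) ⧸ N,
                Function.Surjective ψ ∧ ψ.ker = N'} \ {χ}) := by
  classical
  intro χ hχ
  rw [mem_closure_iff]
  intro o ho hχo
  obtain ⟨I, u, hu, hsub⟩ := isOpen_pi_iff.1 ho χ hχo
  obtain ⟨φ, hsurj, hninj, hinj⟩ := hENH (insert 1 (I.image (QuotientGroup.mk' N)))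
  have hker (x : FreeGroup (Fin n)) :
      x ∈ (φ.comp (QuotientGroup.mk' N)).ker ↔ φ (QuotientGroup.mk' N x) = 1 := Iff.rfl
  have hmk (x : FreeGroup (Fin n)) : QuotientGroup.mk' N x = 1 ↔ x ∈ N :=
    QuotientGroup.eq_one_iff x
  refine ⟨fun x => decide (x ∈ (φ.comp (QuotientGroup.mk' N)).ker), hsub ?_,
    ⟨_, inferInstance, fun x => decide_eq_true_iff, _,
      hsurj.comp (QuotientGroup.mk'_surjective N), rfl⟩, ?_⟩
  · intro x hx
    have hagree : decide (x ∈ (φ.comp (QuotientGroup.mk' N)).ker) = χ x := by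
      rw [Bool.eq_iff_iff, decide_eq_true_iff, hχ, hker, ← hmk]
      refine ⟨fun h => hinj ?_ ?_ (h.trans (map_one φ).symm), fun h => by rw [h, map_one]⟩
      · exact Finset.mem_coe.2 (Finset.mem_insert_of_mem (Finset.mem_image_of_mem _ hx))
      · exact Finset.mem_coe.2 (Finset.mem_insert_self _ _)
    simpa only [hagree] using (hu x hx).2
  · intro heq
    refine hninj ((injective_iff_map_eq_one φ).2 fun g hg => ?_)
    obtain ⟨x, rfl⟩ := QuotientGroup.mk'_surjective N g
    rw [hmk, ← hχ, ← Set.mem_singleton_iff.1 heq]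
    exact decide_eq_true ((hker x).2 hg)
end

section
/- Let F be the free group of finite rank n, let R ⊆ F be a finite subset, let N be the normal closure of R in F, and let G = F/N. Identify the power set of F with the product space F → Prop carrying the product topology, and let S = {s ⊆ F | s is the underlying set of a normal subgroup N' of F with F/N' isomorphic to G}. If the underlying set of N lies in the closure of S ∖ {N} (i.e., the finitely presented group G is condensed at this marking), then G is extremely non-Hopfian: for every finite subset 𝓕 ⊆ G there exists a surjective but non-injective group homomorphism φ : G → G whose restriction to 𝓕 is injective. -/
/-- A finitely presented condensed group is extremely non-Hopfian: if `N` is the normal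
closure of a finite subset `R` of the free group `F` of rank `n`, `G = F/N`, and (the
characteristic function of) `N` is an accumulation point of the isomorphism class of `G`
in the product space `F → Bool`, then for every finite subset `𝓕 ⊆ G` there is a surjective
non-injective endomorphism of `G` injective on `𝓕`. Here a normal subgroup `N'` satisfies
`F/N' ≅ G` iff `N'` is the kernel of a surjective homomorphism `F → G`. -/
theorem stmt11 (n : ℕ) (R : Finset (FreeGroup (Fin n)))
    (hcond : ∃ χ : FreeGroup (Fin n) → Bool,
      (∀ x : FreeGroup (Fin n),
        χ x = true ↔ x ∈ Subgroup.normalClosure (↑R : Set (FreeGroup (Fin n)))) ∧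
      χ ∈ closure
        ({χ' : FreeGroup (Fin n) → Bool |
            ∃ N' : Subgroup (FreeGroup (Fin n)), N'.Normal ∧
              (∀ x : FreeGroup (Fin n), χ' x = true ↔ x ∈ N') ∧
              ∃ ψ : FreeGroup (Fin n) →*
                  FreeGroup (Fin n) ⧸ Subgroup.normalClosure (↑R : Set (FreeGroup (Fin n))),
                Function.Surjective ψ ∧ ψ.ker = N'} \ {χ})) :
    ∀ 𝓕 : Finset (FreeGroup (Fin n) ⧸ Subgroup.normalClosure (↑R : Set (FreeGroup (Fin n)))),
      ∃ φ : (FreeGroup (Fin n) ⧸ Subgroup.normalClosure (↑R : Set (FreeGroup (Fin n)))) →*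
          FreeGroup (Fin n) ⧸ Subgroup.normalClosure (↑R : Set (FreeGroup (Fin n))),
        Function.Surjective φ ∧ ¬Function.Injective φ ∧
          Set.InjOn φ (↑𝓕 : Set (FreeGroup (Fin n) ⧸
            Subgroup.normalClosure (↑R : Set (FreeGroup (Fin n))))) := by
  classical
  obtain ⟨χ, hχ, hcl⟩ := hcond
  set N := Subgroup.normalClosure (↑R : Set (FreeGroup (Fin n)))
  intro 𝓕
  let T : Finset (FreeGroup (Fin n)) :=
    R ∪ (𝓕 ×ˢ 𝓕).image fun p => (Quotient.out p.1)⁻¹ * Quotient.out p.2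
  have hopen : IsOpen {χ' : FreeGroup (Fin n) → Bool | ∀ x ∈ T, χ' x = χ x} := by
    have h : {χ' : FreeGroup (Fin n) → Bool | ∀ x ∈ T, χ' x = χ x} =
        (↑T : Set (FreeGroup (Fin n))).pi fun x => {χ x} := by
      ext χ'
      simp [Set.mem_pi]
    rw [h]
    exact isOpen_set_pi T.finite_toSet fun x _ => isOpen_discrete _
  obtain ⟨χ', hT, ⟨N', -, hχ', ψ, hψ, rfl⟩, hne⟩ :=
    mem_closure_iff.mp hcl _ hopen fun _ _ => rfl
  have hker : ∀ x ∈ T, x ∈ ψ.ker ↔ x ∈ N := fun x hx => by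
    rw [← hχ', ← hχ, hT x hx]
  have hle : N ≤ ψ.ker := Subgroup.normalClosure_le_normal fun r hr =>
    (hker r (Finset.mem_union_left _ hr)).mpr (Subgroup.subset_normalClosure hr)
  have hlift : ∀ x : FreeGroup (Fin n), QuotientGroup.lift N ψ hle (x : _ ⧸ N) = ψ x :=
    fun _ => rfl
  refine ⟨QuotientGroup.lift N ψ hle, fun y => ?_, fun hinj => hne ?_, fun a ha b hb hab => ?_⟩
  · obtain ⟨x, rfl⟩ := hψ y
    exact ⟨x, rfl⟩
  · refine funext fun x => Bool.eq_iff_iff.mpr ?_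
    rw [hχ', hχ]
    refine ⟨fun hx => ?_, fun hx => hle hx⟩
    rw [← QuotientGroup.eq_one_iff]
    exact hinj (by rw [hlift, map_one]; exact hx)
  · have hmem : (Quotient.out a)⁻¹ * Quotient.out b ∈ T :=
      Finset.mem_union_right _
        (Finset.mem_image.mpr ⟨(a, b), Finset.mem_product.mpr ⟨ha, hb⟩, rfl⟩)
    rw [← QuotientGroup.out_eq' a, ← QuotientGroup.out_eq' b, hlift, hlift] at hab
    rw [← QuotientGroup.out_eq' a, ← QuotientGroup.out_eq' b, QuotientGroup.eq]
    refine (hker _ hmem).mp ?_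
    rw [MonoidHom.mem_ker, map_mul, map_inv, hab, inv_mul_cancel]
end

section
/- Let F be the free group on a countably infinite basis (x_i)_{i ∈ ℕ} and identify the power set of F with the product space F → Prop carrying the product topology. Fix a normal subgroup N of F containing x_i for all but finitely many i, and let S = {s ⊆ F | s is the underlying set of a normal subgroup N' of F that contains x_i for all but finitely many i and such that F/N' is isomorphic to F/N}. If some element s₀ ∈ S lies in the closure of S ∖ {s₀}, then every element s ∈ S lies in the closure of S ∖ {s}. In other words, the isomorphism class of a finitely generated group in the space of marked groups is either discrete or has no isolated points. -/
/-- The isomorphism class of the marked group `F/N` inside the space of finitely generated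
marked groups, realized as the set of characteristic functions (in `F → Bool`, with the
product topology) of normal subgroups `N'` of the free group `F` on a countably infinite
basis that contain all but finitely many basis elements and satisfy `F/N' ≅ F/N`; the
isomorphism condition is expressed by `N'` being the kernel of a surjection `F → F/N`. -/
def markedIsoClass (N : Subgroup (FreeGroup ℕ)) [N.Normal] : Set (FreeGroup ℕ → Bool) :=
  {χ : FreeGroup ℕ → Bool |
    ∃ N' : Subgroup (FreeGroup ℕ), N'.Normal ∧
      {i : ℕ | FreeGroup.of i ∉ N'}.Finite ∧
      (∀ x : FreeGroup ℕ, χ x = true ↔ x ∈ N') ∧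
      ∃ ψ : FreeGroup ℕ →* FreeGroup ℕ ⧸ N, Function.Surjective ψ ∧ ψ.ker = N'}

/-- Two surjections from the free group on `ℕ` onto a group that kill almost all basis elements
differ by a surjective endomorphism that fixes almost all basis elements. -/
theorem FreeGroup.exists_surjective_comp_eq {G : Type*} [Group G] {φ ψ : FreeGroup ℕ →* G}
    (hφ : Function.Surjective φ) (hψ : Function.Surjective ψ) {n : ℕ}
    (hφn : ∀ i, n ≤ i → φ (of i) = 1) (hψn : ∀ i, n ≤ i → ψ (of i) = 1) :
    ∃ α : FreeGroup ℕ →* FreeGroup ℕ, Function.Surjective α ∧ φ.comp α = ψ ∧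
      ∀ i, 2 * n ≤ i → α (of i) = of i := by
  let ρ : FreeGroup ℕ →* FreeGroup ℕ := lift fun i => if i < n then of i else 1
  have comp_ρ : ∀ χ : FreeGroup ℕ →* G, (∀ i, n ≤ i → χ (of i) = 1) → ∀ x, χ (ρ x) = χ x := by
    intro χ hχ x
    have : χ.comp ρ = χ := by
      ext i
      by_cases hi : i < n
      · simp [ρ, hi]
      · simp [ρ, hi, hχ i (not_lt.mp hi)]
    exact DFunLike.congr_fun this x
  choose w hw using fun i => hφ (ψ (of i))
  choose v hv using fun i => hψ (φ (of i))
  let β : FreeGroup ℕ →* FreeGroup ℕ := lift fun i => ρ (w i) * of (n + i)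
  let α : FreeGroup ℕ →* FreeGroup ℕ := lift fun i =>
    if i < n then ρ (w i) * of (n + i)
    else if i < 2 * n then (β (ρ (v (i - n))))⁻¹ * of (i - n) else of i
  have hβ : ∀ x, φ (β x) = ψ x := by
    intro x
    have : φ.comp β = ψ := by
      ext i
      simp [β, comp_ρ φ hφn, hw, hφn]
    exact DFunLike.congr_fun this x
  have hαβ : ∀ x, α (ρ x) = β (ρ x) := by
    intro x
    have : α.comp ρ = β.comp ρ := by
      ext i : 1
      by_cases hi : i < n <;> simp [ρ, α, β, hi]
    exact DFunLike.congr_fun this x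
  have low : ∀ i, i < n → of i ∈ α.range := by
    intro i hi
    refine ⟨ρ (v i) * of (n + i), ?_⟩
    have : n + i < 2 * n := by omega
    rw [_root_.map_mul, hαβ]
    simp [α, this]
  have hρ : ρ.range ≤ α.range := by
    refine range_lift_le ?_
    rintro _ ⟨i, rfl⟩
    by_cases hi : i < n
    · simpa [hi] using low i hi
    · simpa only [hi, if_false, SetLike.mem_coe] using α.range.one_mem
  have hα : ∀ i, of i ∈ α.range := by
    intro i
    by_cases hi : i < n
    · exact low i hi
    by_cases hi' : i < 2 * n
    · have h₁ : ρ (w (i - n)) * of i ∈ α.range := by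
        refine ⟨of (i - n), ?_⟩
        have h₂ : i - n < n := by omega
        have h₃ : n + (i - n) = i := by omega
        simp [α, h₂, h₃]
      exact (Subgroup.mul_mem_cancel_left _ (hρ ⟨_, rfl⟩)).mp h₁
    · exact ⟨of i, by simp [α, hi, hi']⟩
  refine ⟨α, ?_, ?_, ?_⟩
  · rw [← MonoidHom.range_eq_top, eq_top_iff, ← closure_range_of, Subgroup.closure_le]
    rintro _ ⟨i, rfl⟩
    exact hα i
  · ext i
    by_cases hi : i < n
    · simp [α, hi, comp_ρ φ hφn, hw, hφn]
    · by_cases hi' : i < 2 * n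
      · simp [α, hi, hi', hβ, comp_ρ ψ hψn, hv, hψn i (not_lt.mp hi)]
      · simp [α, hi, hi', hφn i (not_lt.mp hi), hψn i (not_lt.mp hi)]
  · intro i hi
    have h₁ : ¬ i < n := by omega
    simp [α, h₁, not_lt.mpr hi]

/-- Precomposition with a surjective endomorphism fixing almost all basis elements preserves
the isomorphism class. -/
theorem comp_mem_markedIsoClass {N : Subgroup (FreeGroup ℕ)} [N.Normal]
    {α : FreeGroup ℕ →* FreeGroup ℕ} (hα : Function.Surjective α) {m : ℕ}
    (hm : ∀ i, m ≤ i → α (FreeGroup.of i) = FreeGroup.of i)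
    {χ : FreeGroup ℕ → Bool} (hχ : χ ∈ markedIsoClass N) : χ ∘ α ∈ markedIsoClass N := by
  obtain ⟨N', hN', hfin, hmem, ψ, hψ, rfl⟩ := hχ
  refine ⟨(ψ.comp α).ker, inferInstance, ?_, fun x => hmem (α x), ψ.comp α, hψ.comp hα, rfl⟩
  refine (hfin.union (Set.finite_Iio m)).subset fun i hi => ?_
  by_cases h : i < m
  · exact Or.inr h
  · left
    simpa [MonoidHom.mem_ker, hm i (not_lt.mp h)] using hi

/-- The isomorphism class of a finitely generated group in the space of marked groups is
either discrete or has no isolated points: if some point of the isomorphism class of `F/N`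
is an accumulation point of the class, then every point of the class is. -/
theorem stmt12 (N : Subgroup (FreeGroup ℕ)) [N.Normal]
    (hN : {i : ℕ | FreeGroup.of i ∉ N}.Finite)
    (h : ∃ s₀ ∈ markedIsoClass N, s₀ ∈ closure (markedIsoClass N \ {s₀})) :
    ∀ s ∈ markedIsoClass N, s ∈ closure (markedIsoClass N \ {s}) := by
  obtain ⟨s₀, hs₀, hcl⟩ := h
  intro s hs
  obtain ⟨_, -, hφfin, hφmem, φ, hφ, rfl⟩ := id hs₀
  obtain ⟨_, -, hψfin, hψmem, ψ, hψ, rfl⟩ := hs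
  obtain ⟨b, hb⟩ := (hφfin.union hψfin).bddAbove
  have hφn : ∀ i, b + 1 ≤ i → φ (FreeGroup.of i) = 1 := fun i hi => by
    by_contra hne
    exact absurd (hb (Or.inl hne)) (by omega)
  have hψn : ∀ i, b + 1 ≤ i → ψ (FreeGroup.of i) = 1 := fun i hi => by
    by_contra hne
    exact absurd (hb (Or.inr hne)) (by omega)
  obtain ⟨α, hα, hcomp, hfix⟩ := FreeGroup.exists_surjective_comp_eq hφ hψ hφn hψn
  have hs₀s : s₀ ∘ α = s := by
    funext x
    rw [Bool.eq_iff_iff, hψmem, ← hcomp]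
    exact hφmem (α x)
  have hcont : Continuous fun χ : FreeGroup ℕ → Bool => χ ∘ α :=
    continuous_pi fun x => continuous_apply (α x)
  rw [← hs₀s]
  refine map_mem_closure (f := fun χ : FreeGroup ℕ → Bool => χ ∘ α) hcont hcl ?_
  rintro χ ⟨hχ, hne⟩
  exact ⟨comp_mem_markedIsoClass hα hfix hχ, fun heq => hne (hα.injective_comp_right heq)⟩
end

section
/- Let G be a nontrivial group that is isomorphic to its direct square G × G. Then G is extremely non-Hopfian: for every finite subset 𝓕 ⊆ G there exists a surjective but non-injective group homomorphism φ : G → G whose restriction to 𝓕 is injective. -/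
/-- Identifying `G` with `G × G` repeatedly, the endomorphism that deletes the `n`-th coordinate
of `G ≅ G × (G × (G × ⋯))`. -/
def dropCoord {G : Type*} [Group G] (e : G ≃* G × G) : ℕ → G →* G
  | 0 => (MonoidHom.snd G G).comp e.toMonoidHom
  | n + 1 => e.symm.toMonoidHom.comp
      (((MonoidHom.id G).prodMap (dropCoord e n)).comp e.toMonoidHom)

section dropCoord

variable {G : Type*} [Group G] (e : G ≃* G × G)

lemma dropCoord_zero_apply (x : G) : dropCoord e 0 x = (e x).2 := rfl

lemma dropCoord_succ_apply (n : ℕ) (x : G) :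
    dropCoord e (n + 1) x = e.symm ((e x).1, dropCoord e n (e x).2) := rfl

lemma dropCoord_succ_eq_one_iff (n : ℕ) (x : G) :
    dropCoord e (n + 1) x = 1 ↔ (e x).1 = 1 ∧ dropCoord e n (e x).2 = 1 := by
  rw [dropCoord_succ_apply, map_eq_one_iff e.symm e.symm.injective, Prod.mk_eq_one]

lemma dropCoord_surjective (n : ℕ) : Function.Surjective (dropCoord e n) := by
  induction n with
  | zero => exact Prod.snd_surjective.comp e.surjective
  | succ n ih =>
    exact e.symm.surjective.comp ((Function.surjective_id.prodMap ih).comp e.surjective)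

lemma exists_ne_one_dropCoord_eq_one [Nontrivial G] (n : ℕ) :
    ∃ x : G, x ≠ 1 ∧ dropCoord e n x = 1 := by
  induction n with
  | zero =>
    obtain ⟨g, hg⟩ := exists_ne (1 : G)
    refine ⟨e.symm (g, 1), ?_, ?_⟩
    · simp [map_eq_one_iff e.symm e.symm.injective, hg]
    · simp [dropCoord_zero_apply]
  | succ n ih =>
    obtain ⟨g, hg, hn⟩ := ih
    refine ⟨e.symm (1, g), ?_, ?_⟩
    · simp [map_eq_one_iff e.symm e.symm.injective, hg]
    · simp [dropCoord_succ_eq_one_iff, hn]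

lemma eq_one_of_dropCoord_eq_one {m n : ℕ} (hmn : m < n) {x : G}
    (hm : dropCoord e m x = 1) (hn : dropCoord e n x = 1) : x = 1 := by
  induction m generalizing n x with
  | zero =>
    obtain ⟨k, rfl⟩ := Nat.exists_eq_add_one_of_ne_zero hmn.ne'
    rw [dropCoord_succ_eq_one_iff] at hn
    exact (map_eq_one_iff e e.injective).1 (Prod.ext hn.1 hm)
  | succ m ih =>
    obtain ⟨k, rfl⟩ := Nat.exists_eq_add_one_of_ne_zero (Nat.ne_zero_of_lt hmn)
    rw [dropCoord_succ_eq_one_iff] at hm hn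
    exact (map_eq_one_iff e e.injective).1
      (Prod.ext hn.1 (ih (Nat.lt_of_succ_lt_succ hmn) hm.2 hn.2))

lemma exists_dropCoord_ne_one {S : Set G} (hS : S.Finite) (h1 : 1 ∉ S) :
    ∃ n, ∀ x ∈ S, dropCoord e n x ≠ 1 := by
  by_contra! hcon
  choose f hfS hf using hcon
  obtain ⟨m, n, hmn, hfmn⟩ := hS.exists_lt_map_eq_of_forall_mem hfS
  exact h1 (eq_one_of_dropCoord_eq_one e hmn (hf m) (hfmn ▸ hf n) ▸ hfS m)

end dropCoord

/-- A nontrivial group isomorphic to its direct square is extremely non-Hopfian: for every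
finite subset `𝓕 ⊆ G` there is a surjective non-injective endomorphism of `G` whose
restriction to `𝓕` is injective. -/
theorem stmt13 {G : Type*} [Group G] [Nontrivial G] (h : Nonempty (G ≃* G × G)) :
    ∀ 𝓕 : Finset G, ∃ φ : G →* G,
      Function.Surjective φ ∧ ¬Function.Injective φ ∧ Set.InjOn φ (↑𝓕 : Set G) := by
  intro 𝓕
  obtain ⟨e⟩ := h
  have hfin : (Set.image2 (fun a b : G => a / b) 𝓕 𝓕 \ {1}).Finite :=
    (𝓕.finite_toSet.image2 _ 𝓕.finite_toSet).sdiff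
  obtain ⟨n, hn⟩ := exists_dropCoord_ne_one e hfin (by simp)
  refine ⟨dropCoord e n, dropCoord_surjective e n, fun hinj => ?_, fun a ha b hb hab => ?_⟩
  · obtain ⟨x, hx, hxn⟩ := exists_ne_one_dropCoord_eq_one e n
    exact hx ((map_eq_one_iff _ hinj).1 hxn)
  · by_contra hne
    refine hn (a / b) ⟨Set.mem_image2_of_mem ha hb, fun h1 => hne (div_eq_one.1 h1)⟩ ?_
    rw [map_div, hab, div_self']
end

section
/- Let G be a group and let H be a nontrivial torsion-free subgroup of G such that for every g ∈ G with g ∉ H, the set g⁻¹Hg ∩ H = {h ∈ H | g h g⁻¹ ∈ H} is finite. Then every finite normal subgroup of G is trivial. -/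
/-- Every element of a group has a positive power commuting with a given element of a finite
normal subgroup. -/
theorem Subgroup.Normal.exists_pow_commute {G : Type*} [Group G] {K : Subgroup G}
    (hK : K.Normal) (hfin : (K : Set G).Finite) {k : G} (hk : k ∈ K) (h : G) :
    ∃ m : ℕ, 0 < m ∧ Commute k (h ^ m) := by
  have := hfin.to_subtype
  obtain ⟨a, b, hlt, hab⟩ : ∃ a b : ℕ, a < b ∧ h ^ a * k * (h ^ a)⁻¹ = h ^ b * k * (h ^ b)⁻¹ := by
    obtain ⟨a, b, hne, hab⟩ := Finite.exists_ne_map_eq_of_infinite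
      (fun n : ℕ => (⟨h ^ n * k * (h ^ n)⁻¹, hK.conj_mem k hk _⟩ : (K : Set G)))
    have hab := congrArg Subtype.val hab
    rcases hne.lt_or_gt with hlt | hlt
    · exact ⟨a, b, hlt, hab⟩
    · exact ⟨b, a, hlt, hab.symm⟩
  obtain ⟨m, rfl⟩ := Nat.exists_eq_add_of_lt hlt
  refine ⟨m + 1, m.succ_pos, ?_⟩
  rw [add_assoc, pow_add] at hab
  have hconj : k = h ^ (m + 1) * k * (h ^ (m + 1))⁻¹ := by
    have := congrArg (fun x => (h ^ a)⁻¹ * x * h ^ a) hab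
    simpa only [mul_inv_rev, mul_assoc, inv_mul_cancel_left, inv_mul_cancel, mul_one] using this
  exact eq_mul_inv_iff_mul_eq.mp hconj

/-- If a group `G` has a nontrivial torsion-free subgroup `H` such that `g⁻¹Hg ∩ H` is
finite for every `g ∉ H`, then every finite normal subgroup of `G` is trivial. -/
theorem stmt14 {G : Type*} [Group G] (H : Subgroup G) (hne : H ≠ ⊥)
    (htf : ∀ h : G, h ∈ H → h ≠ 1 → ¬IsOfFinOrder h)
    (hmal : ∀ g : G, g ∉ H → {h : G | h ∈ H ∧ g * h * g⁻¹ ∈ H}.Finite) :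
    ∀ K : Subgroup G, K.Normal → (K : Set G).Finite → K = ⊥ := by
  intro K hK hfin
  rw [Subgroup.eq_bot_iff_forall]
  intro k hk
  by_contra hk1
  have hkH : k ∉ H := fun hkH => htf k hkH hk1 <| by
    have := hfin.to_subtype
    exact K.subtype.isOfFinOrder (isOfFinOrder_of_finite (⟨k, hk⟩ : K))
  obtain ⟨h, hh, hh1⟩ := H.bot_or_exists_ne_one.resolve_left hne
  obtain ⟨m, hm, hcomm⟩ := hK.exists_pow_commute hfin hk h
  have hinj : Function.Injective fun n : ℕ => (h ^ m) ^ n :=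
    injective_pow_iff_not_isOfFinOrder.mpr fun hf => htf h hh hh1 (hf.of_pow hm.ne')
  refine Set.infinite_of_injective_forall_mem hinj (fun n => ?_) (hmal k hkH)
  have hmem : (h ^ m) ^ n ∈ H := H.pow_mem (H.pow_mem hh m) n
  exact ⟨hmem, by rwa [(hcomm.pow_right n).eq, mul_inv_cancel_right]⟩
end
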